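/- Double selector failure, probability that a double-SP-supported row is an SP row: let μ be the product Bernoulli(q) measure on Fin N → Fin N → Bool, 0 < q < 1. Fix φ = {(i,j),(i',j')} with i ≠ i', j ≠ j', and m ∉ {i,i'}. Then the conditional probability, given the event {X i j = true ∧ X i' j' = true ∧ X m j = true ∧ X m j' = true} (both SFs active and row m double-SP-supported), that row m contains an SP cell equals 1 − (q + (1−q)³)^{N−2}. -/

import Mathlib

open MeasureTheory

/-- Bernoulli(q) measure on `Bool`: `true` has probability `q`. -/
noncomputable def bern (q : ℝ) : Measure Bool :=
  (ENNReal.ofReal q) • Measure.dirac true + (ENNReal.ofReal (1 - q)) • Measure.dirac false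

instance (q : ℝ) : IsFiniteMeasure (bern q) := by
  constructor
  simp [bern, Measure.add_apply, Measure.smul_apply]

/-- Product measure on `Fin N → Fin N → Bool` making the `N²` entries i.i.d. Bernoulli(q). -/
noncomputable def arrMeasure (N : ℕ) (q : ℝ) : Measure (Fin N → Fin N → Bool) :=
  Measure.pi fun _ => Measure.pi fun _ => bern q

/-- Cell `(m,n)` is an SP cell for the double-SF set `{(i,j),(i',j')}` (both active). -/
def IsSPCellDouble (N : ℕ) (X : Fin N → Fin N → Bool)
    (i i' j j' m n : Fin N) : Prop :=
  X m n = false ∧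
    ((X i n = true ∧ X m j = true) ∨ (X i' n = true ∧ X m j' = true))

lemma bern_true (q : ℝ) : bern q {true} = ENNReal.ofReal q := by
  simp [bern]

lemma bern_false (q : ℝ) : bern q {false} = ENNReal.ofReal (1 - q) := by
  simp [bern]

lemma bern_prob (q : ℝ) (h0 : 0 < q) (h1 : q < 1) : IsProbabilityMeasure (bern q) := by
  constructor
  simp only [bern, Measure.add_apply, Measure.smul_apply, measure_univ, smul_eq_mul, mul_one]
  rw [← ENNReal.ofReal_add h0.le (by linarith)]
  simp

lemma arr_cols (N : ℕ) (q : ℝ) (A : Fin N → Set (Fin N → Bool)) :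
    arrMeasure N q {X | ∀ n, (fun r => X r n) ∈ A n}
      = ∏ n, (Measure.pi fun _ : Fin N => bern q) (A n) := by
  have hmap : (arrMeasure N q).map (fun X n r => X r n) = arrMeasure N q := by
    apply Measure.ext_of_singleton
    intro Y
    rw [Measure.map_apply (measurable_of_finite _) (measurableSet_singleton _)]
    have : (fun (X : Fin N → Fin N → Bool) n r => X r n) ⁻¹' {Y} = {fun r n => Y n r} := by
      ext X
      simp only [Set.mem_preimage, Set.mem_singleton_iff, funext_iff]
      exact forall_comm
    rw [this]
    simp only [arrMeasure, Measure.pi_singleton]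
    exact Finset.prod_comm
  have h2 : {X : Fin N → Fin N → Bool | ∀ n, (fun r => X r n) ∈ A n}
      = (fun X n r => X r n) ⁻¹' (Set.univ.pi A) := by
    ext X
    simp
  rw [h2, ← Measure.map_apply (measurable_of_finite _) (Set.toFinite _).measurableSet, hmap,
    arrMeasure, Measure.pi_pi]

lemma box (N : ℕ) (q : ℝ) (h0 : 0 < q) (h1 : q < 1) (s : Finset (Fin N)) (b : Fin N → Bool) :
    (Measure.pi fun _ : Fin N => bern q) {Y | ∀ r ∈ s, Y r = b r} = ∏ r ∈ s, bern q {b r} := by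
  haveI := bern_prob q h0 h1
  have : {Y : Fin N → Bool | ∀ r ∈ s, Y r = b r}
      = Set.univ.pi (fun r => if r ∈ s then {b r} else Set.univ) := by
    ext Y
    simp only [Set.mem_setOf_eq, Set.mem_pi, Set.mem_univ, true_implies]
    refine forall_congr' fun r => ?_
    by_cases h : r ∈ s <;> simp [h]
  rw [this, Measure.pi_pi]
  have : ∀ r, bern q (if r ∈ s then {b r} else Set.univ) = if r ∈ s then bern q {b r} else 1 := by
    intro r
    split_ifs
    · rfl
    · exact measure_univ
  simp only [this]
  rw [Finset.prod_ite_mem, Finset.univ_inter]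

lemma box_two (N : ℕ) (q : ℝ) (h0 : 0 < q) (h1 : q < 1) (i m : Fin N) (h : m ≠ i) :
    (Measure.pi fun _ : Fin N => bern q) {Y | Y i = true ∧ Y m = true}
      = ENNReal.ofReal (q ^ 2) := by
  have := box N q h0 h1 {i, m} (fun _ => true)
  rw [Finset.prod_pair h.symm, bern_true, ← ENNReal.ofReal_mul h0.le, ← sq] at this
  rw [← this]
  congr 1
  ext Y
  simp

lemma box_good (N : ℕ) (q : ℝ) (h0 : 0 < q) (h1 : q < 1) (i i' m : Fin N) (hii : i ≠ i')
    (h : m ≠ i) (h' : m ≠ i') :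
    (Measure.pi fun _ : Fin N => bern q) {Y | Y m = true ∨ (Y i = false ∧ Y i' = false)}
      = ENNReal.ofReal (q + (1 - q) ^ 3) := by
  have e1 := box N q h0 h1 {m} (fun _ => true)
  have e2 := box N q h0 h1 {m, i, i'} (fun _ => false)
  have hq : 0 ≤ 1 - q := by linarith
  rw [Finset.prod_singleton, bern_true] at e1
  rw [Finset.prod_insert (by simp [h, h']), Finset.prod_pair hii, bern_false,
    ← ENNReal.ofReal_mul hq, ← ENNReal.ofReal_mul hq] at e2
  have : {Y : Fin N → Bool | Y m = true ∨ (Y i = false ∧ Y i' = false)}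
    = {Y | ∀ r ∈ ({m} : Finset (Fin N)), Y r = true}
      ∪ {Y | ∀ r ∈ ({m, i, i'} : Finset (Fin N)), Y r = false} := by
    ext Y
    simp
    cases Y m <;> simp
  rw [this, measure_union _ (Set.toFinite _).measurableSet, e1, e2,
    ← ENNReal.ofReal_add h0.le (by positivity)]
  · congr 1
    ring
  · rw [Set.disjoint_left]
    intro Y hY hY'
    simp at hY hY'
    simp [hY] at hY'

lemma prod_two (N : ℕ) (j j' : Fin N) (h : j ≠ j') (f : Fin N → ENNReal) (a b c : ENNReal)
    (ha : f j = a) (hb : f j' = b) (hc : ∀ n, n ≠ j → n ≠ j' → f n = c) :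
    ∏ n, f n = a * b * c ^ (N - 2) := by
  rw [← Finset.prod_mul_prod_compl {j, j'} f, Finset.prod_pair h, ha, hb,
    Finset.prod_congr rfl (g := fun _ => c), Finset.prod_const, Finset.card_compl,
    Finset.card_pair h, Fintype.card_fin]
  intro n hn
  simp at hn
  exact hc n hn.1 hn.2

/-- Double selector failure: conditioned on both SFs being active and
row `m ∉ {i,i'}` being double-SP-supported, the probability that row `m` contains
an SP cell equals `1 − (q + (1−q)³)^{N−2}`. -/
theorem double_sf_double_supported_row_is_sp_row_prob
    (N : ℕ) (hN : 2 ≤ N) (q : ℝ) (hq0 : 0 < q) (hq1 : q < 1)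
    (i i' j j' m : Fin N)
    (hii : i ≠ i') (hjj : j ≠ j') (hmi : m ≠ i) (hmi' : m ≠ i') :
    (arrMeasure N q) ({X : Fin N → Fin N → Bool |
        ∃ n : Fin N, IsSPCellDouble N X i i' j j' m n} ∩
      {X : Fin N → Fin N → Bool |
        X i j = true ∧ X i' j' = true ∧ X m j = true ∧ X m j' = true})
      / (arrMeasure N q) {X : Fin N → Fin N → Bool |
        X i j = true ∧ X i' j' = true ∧ X m j = true ∧ X m j' = true}
    = ENNReal.ofReal (1 - (q + (1 - q) ^ 3) ^ (N - 2)) := by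
  haveI := bern_prob q hq0 hq1
  haveI : IsProbabilityMeasure (arrMeasure N q) := by unfold arrMeasure; infer_instance
  set C := {X : Fin N → Fin N → Bool |
        X i j = true ∧ X i' j' = true ∧ X m j = true ∧ X m j' = true} with hC
  set S := {X : Fin N → Fin N → Bool | ∃ n : Fin N, IsSPCellDouble N X i i' j j' m n} with hS
  have key : ∀ G : Set (Fin N → Bool),
      arrMeasure N q {X | ∀ n, (fun r => X r n) ∈ (if n = j then {Y | Y i = true ∧ Y m = true}
        else if n = j' then {Y | Y i' = true ∧ Y m = true} else G : Set (Fin N → Bool))}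
      = ENNReal.ofReal (q ^ 2) * ENNReal.ofReal (q ^ 2)
        * ((Measure.pi fun _ : Fin N => bern q) G) ^ (N - 2) := by
    intro G
    rw [arr_cols]
    apply prod_two N j j' hjj
    · rw [if_pos rfl, box_two N q hq0 hq1 i m hmi]
    · rw [if_neg hjj.symm, if_pos rfl, box_two N q hq0 hq1 i' m hmi']
    · intro n h h'
      rw [if_neg h, if_neg h']
  have hsplit : ∀ (X : Fin N → Fin N → Bool) (G : Set (Fin N → Bool)),
      (∀ n, (fun r => X r n) ∈ (if n = j then {Y | Y i = true ∧ Y m = true}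
        else if n = j' then {Y | Y i' = true ∧ Y m = true} else G : Set (Fin N → Bool)))
      ↔ X ∈ C ∧ ∀ n, n ≠ j → n ≠ j' → (fun r => X r n) ∈ G := by
    intro X G
    constructor
    · intro h
      have h1 := h j
      have h2 := h j'
      rw [if_pos rfl] at h1
      rw [if_neg hjj.symm, if_pos rfl] at h2
      refine ⟨⟨h1.1, h2.1, h1.2, h2.2⟩, fun n hn hn' => ?_⟩
      have h3 := h n
      rwa [if_neg hn, if_neg hn'] at h3
    · rintro ⟨⟨a, b, c, d⟩, h⟩ n
      split_ifs with h1 h2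
      · subst h1; exact ⟨a, c⟩
      · subst h2; exact ⟨b, d⟩
      · exact h n h1 h2
  have hCm : arrMeasure N q C = ENNReal.ofReal (q ^ 4) := by
    have := key Set.univ
    simp only [hsplit] at this
    simp only [Set.mem_univ, implies_true, and_true, Set.setOf_mem_eq, measure_univ, one_pow,
      mul_one] at this
    rw [this, ← ENNReal.ofReal_mul (by positivity)]
    congr 1
    ring
  have hg : 0 ≤ q + (1 - q) ^ 3 := by
    have : 0 ≤ 1 - q := by linarith
    positivity
  have hNm : arrMeasure N q (C \ S)
      = ENNReal.ofReal (q ^ 4 * (q + (1 - q) ^ 3) ^ (N - 2)) := by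
    have := key {Y | Y m = true ∨ (Y i = false ∧ Y i' = false)}
    simp only [hsplit] at this
    rw [box_good N q hq0 hq1 i i' m hii hmi hmi', ← ENNReal.ofReal_pow hg,
      ← ENNReal.ofReal_mul (by positivity), ← ENNReal.ofReal_mul (by positivity)] at this
    have e : q ^ 4 = q ^ 2 * q ^ 2 := by ring
    rw [e, ← this]
    congr 1
    ext X
    simp only [Set.mem_diff, Set.mem_setOf_eq]
    refine and_congr_right fun hX => ?_
    obtain ⟨a, b, c, d⟩ := hX
    simp only [hS, Set.mem_setOf_eq, IsSPCellDouble, c, d, and_true, not_exists]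
    constructor
    · intro h n _ _
      have := h n
      revert this
      cases X m n <;> cases X i n <;> cases X i' n <;> simp
    · intro h n
      by_cases h1 : n = j
      · subst h1; simp [c]
      by_cases h2 : n = j'
      · subst h2; simp [d]
      have := h n h1 h2
      revert this
      cases X m n <;> cases X i n <;> cases X i' n <;> simp
  have hsum : arrMeasure N q (S ∩ C) = arrMeasure N q C - arrMeasure N q (C \ S) := by
    have := measure_inter_add_diff (μ := arrMeasure N q) C (t := S) (Set.toFinite _).measurableSet
    rw [← this, Set.inter_comm, ENNReal.add_sub_cancel_right (measure_ne_top _ _)]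
  rw [hsum, hCm, hNm, ← ENNReal.ofReal_sub _ (by positivity),
    ← ENNReal.ofReal_div_of_pos (by positivity)]
  congr 1
  field_simp
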